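/- The function g : ℝ₊² → ℝ₊ defined by g(c,d) = (1/2) · min_{(x,y)∈[0,1]²} max( d·x − h₂(x) + c·y − h₂(y) , l(x,y) ), with l(x,y) = min_{(a,b)∈T(x,y)} ((1−x)²a² + (1−y)²b²)/(8 ln 2) and T(x,y) = {(a,b) ∈ ℝ₊² : a ≥ (4y−2)⁺, b ≥ (4x−2)⁺, a+b ≥ 2−x−y}, is doubly-increasing (increasing in each argument when the other is fixed), satisfies g(c,d) = 0 if and only if c = d = 0, and lim_{(c,d)→(∞,∞)} g(c,d) = 1/(8 ln 2) = (log₂ e)/8. -/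

import Mathlib

/-- Binary entropy function (in bits), with the convention `0 * log₂ 0 = 0`. -/
noncomputable def H2 (x : ℝ) : ℝ := -(x * Real.logb 2 x) - (1 - x) * Real.logb 2 (1 - x)

/-- The constraint set `T(x,y) = {(a,b) ∈ ℝ₊² : a ≥ (4y−2)⁺, b ≥ (4x−2)⁺, a+b ≥ 2−x−y}`. -/
def Tset (x y : ℝ) : Set (ℝ × ℝ) :=
  {ab | 0 ≤ ab.1 ∧ 0 ≤ ab.2 ∧ max (4 * y - 2) 0 ≤ ab.1 ∧ max (4 * x - 2) 0 ≤ ab.2 ∧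
    2 - x - y ≤ ab.1 + ab.2}

/-- `l(x,y) = min_{(a,b) ∈ T(x,y)} ((1−x)²a² + (1−y)²b²)/(8 ln 2)`. -/
noncomputable def lfun (x y : ℝ) : ℝ :=
  sInf ((fun ab : ℝ × ℝ => ((1 - x) ^ 2 * ab.1 ^ 2 + (1 - y) ^ 2 * ab.2 ^ 2) / (8 * Real.log 2))
    '' Tset x y)

/-- `g(c,d) = (1/2)·min_{(x,y)∈[0,1]²} max( d·x − h₂(x) + c·y − h₂(y) , l(x,y) )`. -/
noncomputable def gNIID (c d : ℝ) : ℝ :=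
  (1 / 2) * sInf ((fun xy : ℝ × ℝ =>
      max (d * xy.1 - H2 xy.1 + c * xy.2 - H2 xy.2) (lfun xy.1 xy.2))
    '' (Set.Icc (0 : ℝ) 1 ×ˢ Set.Icc (0 : ℝ) 1))

lemma H2_eq (x : ℝ) : H2 x = Real.binEntropy x / Real.log 2 := by
  unfold H2 Real.binEntropy
  simp only [Real.logb, Real.log_inv]
  ring

lemma H2_cont : Continuous H2 := by
  have : H2 = fun x => Real.binEntropy x / Real.log 2 := funext H2_eq
  rw [this]
  exact Real.binEntropy_continuous.div_const _

lemma log2_pos : 0 < Real.log 2 := Real.log_pos (by norm_num)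

lemma H2_le (x : ℝ) : H2 x ≤ 1 := by
  rw [H2_eq, div_le_one log2_pos]
  exact Real.binEntropy_le_log_two

lemma Tset_nonempty (x y : ℝ) : (Tset x y).Nonempty := by
  refine ⟨(max (4 * y - 2) 0 + |2 - x - y|, max (4 * x - 2) 0), ?_⟩
  have h1 := le_max_right (4 * y - 2) 0
  have h2 := le_max_right (4 * x - 2) 0
  have h3 := le_abs_self (2 - x - y)
  have h4 := abs_nonneg (2 - x - y)
  refine ⟨?_, ?_, ?_, ?_, ?_⟩ <;> simp only [] <;> linarith

lemma le_lfun (x y m : ℝ)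
    (h : ∀ a b : ℝ, 0 ≤ a → 0 ≤ b → 4 * y - 2 ≤ a → 4 * x - 2 ≤ b → 2 - x - y ≤ a + b →
      m ≤ (1 - x) ^ 2 * a ^ 2 + (1 - y) ^ 2 * b ^ 2) :
    m / (8 * Real.log 2) ≤ lfun x y := by
  refine le_csInf ((Tset_nonempty x y).image _) ?_
  rintro _ ⟨⟨a, b⟩, ⟨h1, h2, h3, h4, h5⟩, rfl⟩
  have := log2_pos
  exact div_le_div_of_nonneg_right
    (h a b h1 h2 ((le_max_left _ _).trans h3) ((le_max_left _ _).trans h4) h5) (by positivity)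

lemma lfun_nonneg (x y : ℝ) : 0 ≤ lfun x y := by
  have := le_lfun x y 0 (fun a b _ _ _ _ _ => by positivity)
  simpa using this

lemma lfun_le (x y a b : ℝ) (h : (a, b) ∈ Tset x y) :
    lfun x y ≤ ((1 - x) ^ 2 * a ^ 2 + (1 - y) ^ 2 * b ^ 2) / (8 * Real.log 2) := by
  refine csInf_le ⟨0, ?_⟩ ⟨(a, b), h, rfl⟩
  rintro _ ⟨⟨a, b⟩, -, rfl⟩
  have := log2_pos
  positivity

lemma aux (u v a b : ℝ) (hv : 0 ≤ v) (huv : v ≤ u) (ha0 : 0 ≤ a) (hb0 : 0 ≤ b)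
    (ha : 2 - 4 * v ≤ a) (hab : u + v ≤ a + b) :
    (u + v) ^ 2 / 32 ≤ u ^ 2 * a ^ 2 + v ^ 2 * b ^ 2 := by
  rcases le_total v (1 / 4) with h | h
  · have h1 : 1 ≤ a ^ 2 := by nlinarith
    have h2 : u ^ 2 * 1 ≤ u ^ 2 * a ^ 2 := by gcongr
    have h3 : 0 ≤ v ^ 2 * b ^ 2 := by positivity
    nlinarith
  · have h1 : (1 / 4) ^ 2 * a ^ 2 ≤ u ^ 2 * a ^ 2 := by gcongr; linarith
    have h2 : (1 / 4) ^ 2 * b ^ 2 ≤ v ^ 2 * b ^ 2 := by gcongr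
    have h3 : (u + v) ^ 2 ≤ (a + b) ^ 2 := by gcongr; linarith
    nlinarith [sq_nonneg (a - b)]

lemma lfun_lower (x y : ℝ) (hx : x ≤ 1) (hy : y ≤ 1) :
    ((1 - x) + (1 - y)) ^ 2 / 32 / (8 * Real.log 2) ≤ lfun x y := by
  refine le_lfun x y _ fun a b ha hb h1 h2 h3 => ?_
  rcases le_total x y with h | h
  · exact aux (1 - x) (1 - y) a b (by linarith) (by linarith) ha hb (by linarith) (by linarith)
  · have := aux (1 - y) (1 - x) b a (by linarith) (by linarith) hb ha (by linarith) (by linarith)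
    linarith

lemma lfun_near (x y δ : ℝ) (h1 : δ ≤ 1) (hx : x ≤ δ) (hy : y ≤ δ) :
    2 * (1 - δ) ^ 4 / (8 * Real.log 2) ≤ lfun x y := by
  refine le_lfun x y _ fun a b ha hb _ _ h3 => ?_
  have h4 : (1 - δ) ^ 2 * a ^ 2 ≤ (1 - x) ^ 2 * a ^ 2 := by gcongr
  have h5 : (1 - δ) ^ 2 * b ^ 2 ≤ (1 - y) ^ 2 * b ^ 2 := by gcongr
  have h6 : (2 * (1 - δ)) ^ 2 ≤ (a + b) ^ 2 := by
    gcongr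
    · linarith
  have h7 : 2 * (1 - δ) ^ 2 ≤ a ^ 2 + b ^ 2 := by nlinarith [sq_nonneg (a - b)]
  have h8 : (1 - δ) ^ 2 * (2 * (1 - δ) ^ 2) ≤ (1 - δ) ^ 2 * (a ^ 2 + b ^ 2) := by gcongr
  nlinarith

lemma le_gNIID (c d m : ℝ)
    (h : ∀ x y : ℝ, 0 ≤ x → x ≤ 1 → 0 ≤ y → y ≤ 1 →
      m ≤ max (d * x - H2 x + c * y - H2 y) (lfun x y)) : 1 / 2 * m ≤ gNIID c d := by
  unfold gNIID
  refine mul_le_mul_of_nonneg_left ?_ (by norm_num)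
  refine le_csInf (Set.Nonempty.image _ ⟨(0, 0), by simp⟩) ?_
  rintro _ ⟨⟨x, y⟩, ⟨hx, hy⟩, rfl⟩
  exact h x y hx.1 hx.2 hy.1 hy.2

lemma gNIID_le (c d x y : ℝ) (h0 : 0 ≤ x) (h1 : x ≤ 1) (h2 : 0 ≤ y) (h3 : y ≤ 1) :
    gNIID c d ≤ 1 / 2 * max (d * x - H2 x + c * y - H2 y) (lfun x y) := by
  unfold gNIID
  refine mul_le_mul_of_nonneg_left ?_ (by norm_num)
  refine csInf_le ⟨0, ?_⟩ ⟨(x, y), ⟨⟨h0, h1⟩, ⟨h2, h3⟩⟩, rfl⟩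
  rintro _ ⟨⟨x, y⟩, -, rfl⟩
  exact le_max_of_le_right (lfun_nonneg x y)

lemma gNIID_mono (c d c' d' : ℝ) (hc : c ≤ c') (hd : d ≤ d') : gNIID c d ≤ gNIID c' d' := by
  have : 1 / 2 * (2 * gNIID c d) ≤ gNIID c' d' := by
    refine le_gNIID _ _ _ fun x y h0 h1 h2 h3 => ?_
    have := gNIID_le c d x y h0 h1 h2 h3
    have h4 : max (d * x - H2 x + c * y - H2 y) (lfun x y) ≤
        max (d' * x - H2 x + c' * y - H2 y) (lfun x y) := by gcongr
    linarith
  linarith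

lemma H2_zero : H2 0 = 0 := by simp [H2]
lemma H2_one : H2 1 = 0 := by simp [H2]

lemma gNIID_nonneg (c d : ℝ) : 0 ≤ gNIID c d := by
  have := le_gNIID c d 0 fun x y _ _ _ _ => le_max_of_le_right (lfun_nonneg x y)
  simpa using this

lemma gNIID_pos (c d : ℝ) (h : 0 < c + d) : 0 < gNIID c d := by
  have hl := log2_pos
  have hH := H2_cont
  let f : ℝ × ℝ → ℝ := fun p => max (d * p.1 - H2 p.1 + c * p.2 - H2 p.2)
    (((1 - p.1) + (1 - p.2)) ^ 2 / 32 / (8 * Real.log 2))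
  have hf : Continuous f := by
    have e1 : Continuous fun p : ℝ × ℝ => H2 p.1 := hH.comp continuous_fst
    have e2 : Continuous fun p : ℝ × ℝ => H2 p.2 := hH.comp continuous_snd
    refine Continuous.max (by fun_prop) ?_
    refine Continuous.div_const ?_ _
    fun_prop
  obtain ⟨p, hp, hmin⟩ := (isCompact_Icc.prod isCompact_Icc :
    IsCompact (Set.Icc (0 : ℝ) 1 ×ˢ Set.Icc (0 : ℝ) 1)).exists_isMinOn
      ⟨(0, 0), by simp⟩ hf.continuousOn
  obtain ⟨⟨hx0, hx1⟩, ⟨hy0, hy1⟩⟩ := hp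
  have hpos : 0 < f p := by
    rcases (by linarith : 0 ≤ (1 - p.1) + (1 - p.2)).lt_or_eq with h1 | h1
    · exact lt_max_of_lt_right (by positivity)
    · have e1 : p.1 = 1 := by linarith
      have e2 : p.2 = 1 := by linarith
      refine lt_max_of_lt_left ?_
      rw [e1, e2, H2_one]
      linarith
  have := le_gNIID c d (f p) fun x y h0 h1 h2 h3 => by
    have h4 : f p ≤ f (x, y) := hmin (show (x, y) ∈ _ from ⟨⟨h0, h1⟩, ⟨h2, h3⟩⟩)
    exact h4.trans (max_le_max le_rfl (lfun_lower x y h1 h3))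
  linarith

lemma gNIID_zero : gNIID 0 0 = 0 := by
  refine le_antisymm ?_ (gNIID_nonneg _ _)
  have h1 := gNIID_le 0 0 1 1 (by norm_num) (by norm_num) (by norm_num) (by norm_num)
  have h2 := lfun_le 1 1 2 2 (by norm_num [Tset])
  rw [H2_one] at h1
  have h3 : lfun 1 1 ≤ 0 := by simpa using h2
  have h4 : max ((0 : ℝ) * 1 - 0 + 0 * 1 - 0) (lfun 1 1) ≤ 0 := max_le (by norm_num) h3
  exact h1.trans (mul_nonpos_of_nonneg_of_nonpos (by norm_num) h4)

lemma gNIID_upper (c d : ℝ) : gNIID c d ≤ 1 / (8 * Real.log 2) := by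
  have hl := log2_pos
  have h1 := gNIID_le c d 0 0 (by norm_num) (by norm_num) (by norm_num) (by norm_num)
  have h2 := lfun_le 0 0 1 1 (by norm_num [Tset])
  rw [H2_zero] at h1
  have h3 : ((1 - (0 : ℝ)) ^ 2 * 1 ^ 2 + (1 - 0) ^ 2 * 1 ^ 2) / (8 * Real.log 2)
    = 2 * (1 / (8 * Real.log 2)) := by ring
  have h5 : 0 < 1 / (8 * Real.log 2) := by positivity
  have h4 : max (d * 0 - 0 + c * 0 - 0) (lfun 0 0) ≤ 2 * (1 / (8 * Real.log 2)) :=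
    max_le (by simp only [mul_zero]; linarith) (by linarith)
  linarith

lemma gNIID_near (c d δ : ℝ) (h0 : 0 < δ) (h1 : δ < 1)
    (hc : (2 + 2 * (1 - δ) ^ 4 / (8 * Real.log 2)) / δ ≤ c)
    (hd : (2 + 2 * (1 - δ) ^ 4 / (8 * Real.log 2)) / δ ≤ d) :
    (1 - δ) ^ 4 * (1 / (8 * Real.log 2)) ≤ gNIID c d := by
  have hl := log2_pos
  have hM : 0 ≤ 2 * (1 - δ) ^ 4 / (8 * Real.log 2) := by positivity
  have hM' : 0 ≤ (2 + 2 * (1 - δ) ^ 4 / (8 * Real.log 2)) / δ := by positivity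
  have := le_gNIID c d (2 * (1 - δ) ^ 4 / (8 * Real.log 2)) fun x y hx0 hx1 hy0 hy1 => by
    rw [div_le_iff₀ h0] at hc hd
    have hc0 : 0 ≤ c := by by_contra hh; push Not at hh; nlinarith
    have hd0 : 0 ≤ d := by by_contra hh; push Not at hh; nlinarith
    have e1 := H2_le x
    have e2 := H2_le y
    have e3 : 0 ≤ c * y := by positivity
    have e4 : 0 ≤ d * x := by positivity
    rcases le_total x δ with hx | hx
    · rcases le_total y δ with hy | hy
      · exact le_max_of_le_right (lfun_near x y δ h1.le hx hy)
      · have : c * δ ≤ c * y := by gcongr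
        exact le_max_of_le_left (by linarith)
    · have : d * δ ≤ d * x := by gcongr
      exact le_max_of_le_left (by linarith)
  calc _ = 1 / 2 * (2 * (1 - δ) ^ 4 / (8 * Real.log 2)) := by ring
    _ ≤ _ := this

/-- `g(c,d)` is doubly-increasing, vanishes exactly at `(0,0)`, and tends to
`1/(8 ln 2) = (log₂ e)/8` as `(c,d) → (∞,∞)`. -/
theorem stmt4 :
    (∀ d : ℝ, 0 ≤ d → MonotoneOn (fun c => gNIID c d) (Set.Ici 0)) ∧
    (∀ c : ℝ, 0 ≤ c → MonotoneOn (fun d => gNIID c d) (Set.Ici 0)) ∧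
    (∀ c d : ℝ, 0 ≤ c → 0 ≤ d → (gNIID c d = 0 ↔ c = 0 ∧ d = 0)) ∧
    Filter.Tendsto (fun cd : ℝ × ℝ => gNIID cd.1 cd.2) (Filter.atTop ×ˢ Filter.atTop)
      (nhds (1 / (8 * Real.log 2))) ∧
    1 / (8 * Real.log 2) = Real.logb 2 (Real.exp 1) / 8 := by
  refine ⟨?_, ?_, ?_, ?_, ?_⟩
  · intro d _ c _ c' _ h
    exact gNIID_mono _ _ _ _ h le_rfl
  · intro c _ d _ d' _ h
    exact gNIID_mono _ _ _ _ le_rfl h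
  · intro c d hc hd
    constructor
    · intro h
      by_contra hne
      have : 0 < c + d := by
        rcases (add_nonneg hc hd).lt_or_eq with h1 | h1
        · exact h1
        · exact absurd ⟨by linarith, by linarith⟩ hne
      exact (gNIID_pos c d this).ne' h
    · rintro ⟨rfl, rfl⟩
      exact gNIID_zero
  · refine tendsto_order.2 ⟨fun a ha => ?_, fun a ha => ?_⟩
    · have hcont : Filter.Tendsto (fun δ : ℝ => (1 - δ) ^ 4 * (1 / (8 * Real.log 2)))
          (nhdsWithin 0 (Set.Ioi 0)) (nhds (1 / (8 * Real.log 2))) := by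
        have : Continuous (fun δ : ℝ => (1 - δ) ^ 4 * (1 / (8 * Real.log 2))) := by
          refine Continuous.mul ?_ continuous_const
          fun_prop
        have h := this.tendsto 0
        simp only [sub_zero, one_pow, one_mul] at h
        exact h.mono_left nhdsWithin_le_nhds
      have h1 := hcont.eventually (lt_mem_nhds ha)
      have h2 : ∀ᶠ δ : ℝ in nhdsWithin 0 (Set.Ioi 0), δ ∈ Set.Ioo (0 : ℝ) 1 :=
        Ioo_mem_nhdsGT one_pos
      obtain ⟨δ, hδ, hδ0, hδ1⟩ := (h1.and h2).exists
      have h3 := Filter.eventually_ge_atTop ((2 + 2 * (1 - δ) ^ 4 / (8 * Real.log 2)) / δ)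
      filter_upwards [h3.prod_mk h3] with p hp
      exact hδ.trans_le (gNIID_near _ _ δ hδ0 hδ1 hp.1 hp.2)
    · exact Filter.Eventually.of_forall fun p => (gNIID_upper _ _).trans_lt ha
  · rw [Real.logb, Real.log_exp]
    ring
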